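/- arXiv:2301.09502 — 2 statements merged into one kernel-verified Lean document; each statement's English description precedes it below -/
import Mathlib

section
/- Let G be a virtually solvable subgroup of SL(2,ℤ). Then exactly one of the following six conditions holds: (i) G is the trivial group; (ii) G contains a torsion element; (iii) G is infinite cyclic generated by a twisted inversion; (iv) G is infinite cyclic generated by a shear; (v) G is infinite cyclic generated by an inverting scale; (vi) G is infinite cyclic generated by a positive scale. -/
abbrev SL2Z := Matrix.SpecialLinearGroup (Fin 2) ℤ

/-- A *shear*: trace `2` and not the identity. -/
def IsShear (A : SL2Z) : Prop :=
  Matrix.trace (A : Matrix (Fin 2) (Fin 2) ℤ) = 2 ∧ A ≠ 1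

/-- A *twisted inversion*: trace `-2` and not `-I`. -/
def IsTwistedInversion (A : SL2Z) : Prop :=
  Matrix.trace (A : Matrix (Fin 2) (Fin 2) ℤ) = -2 ∧ (A : Matrix (Fin 2) (Fin 2) ℤ) ≠ -1

/-- A *positive scale*: trace at least `3` (larger eigenvalue `λ > 1`). -/
def IsPositiveScale (A : SL2Z) : Prop :=
  3 ≤ Matrix.trace (A : Matrix (Fin 2) (Fin 2) ℤ)

/-- An *inverting scale*: trace at most `-3` (eigenvalue `λ < -1`). -/
def IsInvertingScale (A : SL2Z) : Prop :=
  Matrix.trace (A : Matrix (Fin 2) (Fin 2) ℤ) ≤ -3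

/-- `G` is infinite cyclic generated by an element `A` with property `P`. -/
def IsInfiniteCyclicWithGenerator (G : Subgroup SL2Z) (P : SL2Z → Prop) : Prop :=
  ∃ A : SL2Z, P A ∧ G = Subgroup.zpowers A ∧ Function.Injective fun n : ℤ => A ^ n

lemma aux_prop (a b c a' b' c' : ℚ) (h : ¬ (a = 0 ∧ b = 0 ∧ c = 0)) (h1 : a * b' = a' * b)
    (h2 : a * c' = a' * c) (h3 : b * c' = b' * c) : ∃ u : ℚ, a' = u * a ∧ b' = u * b ∧ c' = u * c := by
  by_cases ha : a = 0
  · by_cases hb : b = 0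
    · have hc : c ≠ 0 := fun hc => h ⟨ha, hb, hc⟩
      refine ⟨c' / c, ?_, ?_, ?_⟩ <;> field_simp <;> linarith
    · refine ⟨b' / b, ?_, ?_, ?_⟩ <;> field_simp <;> linarith
  · refine ⟨a' / a, ?_, ?_, ?_⟩ <;> field_simp <;> linarith

lemma aux_root (v : ℚ) (t : ℤ) (h : v ^ 2 - t * v + 1 = 0) : v = 1 ∨ v = -1 := by
  have hv : IsIntegral ℤ v := by
    refine ⟨Polynomial.X ^ 2 - Polynomial.C t * Polynomial.X + 1, ?_, ?_⟩
    · monicity!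
    · simpa [Polynomial.eval₂_add, Polynomial.eval₂_sub, Polynomial.eval₂_mul, -eq_intCast, -map_intCast] using h
  obtain ⟨k, hk⟩ := IsIntegrallyClosed.isIntegral_iff.mp hv
  simp only [algebraMap_int_eq, eq_intCast] at hk
  subst hk
  have h' : k ^ 2 - t * k + 1 = 0 := by exact_mod_cast h
  have h2 : k * (t - k) = 1 := by linarith
  rcases Int.eq_one_or_neg_one_of_mul_eq_one h2 with h | h <;> simp [h]

/-- The traceless part `n = (c, a; b, -c)`, with `g n = u n g`, forces `u = 1`. -/
lemma aux_key (x y z w : ℤ) (hdet : x * w - y * z = 1) (ht : x + w ≠ 0) (a b c u : ℚ)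
    (h : ¬ (a = 0 ∧ b = 0 ∧ c = 0))
    (E1 : x * c + y * b = u * (c * x + a * z)) (E2 : x * a - y * c = u * (c * y + a * w))
    (E3 : z * c + w * b = u * (b * x - c * z)) (E4 : z * a - w * c = u * (b * y - c * w)) :
    u = 1 := by
  by_contra hu
  have hd : (x : ℚ) * w - y * z = 1 := by exact_mod_cast hdet
  have hτ : (x : ℚ) + w ≠ 0 := by exact_mod_cast ht
  have S : (x : ℚ) * c + y * b + z * a - w * c = 0 := by
    have : (1 - u) * ((x : ℚ) * c + y * b + z * a - w * c) = 0 := by linear_combination E1 + E4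
    rcases mul_eq_zero.mp this with h | h
    · exact absurd (by linarith) hu
    · exact h
  obtain ⟨m1, hm1⟩ : ∃ m : ℚ, m = c * x + a * z := ⟨_, rfl⟩
  obtain ⟨m2, hm2⟩ : ∃ m : ℚ, m = c * y + a * w := ⟨_, rfl⟩
  obtain ⟨m3, hm3⟩ : ∃ m : ℚ, m = b * x - c * z := ⟨_, rfl⟩
  obtain ⟨m4, hm4⟩ : ∃ m : ℚ, m = b * y - c * w := ⟨_, rfl⟩
  rw [← hm1] at E1
  rw [← hm2] at E2
  rw [← hm3] at E3
  rw [← hm4] at E4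
  -- g m = n
  have G1 : x * m1 + y * m3 = c := by simp only [hm1, hm3]; linear_combination x * S + c * hd
  have G2 : x * m2 + y * m4 = a := by simp only [hm2, hm4]; linear_combination y * S + a * hd
  have G3 : z * m1 + w * m3 = b := by simp only [hm1, hm3]; linear_combination z * S + b * hd
  have G4 : z * m2 + w * m4 = -c := by simp only [hm2, hm4]; linear_combination w * S - c * hd
  -- m g = τ m - n
  have C1 : m1 * x + m2 * z = (x + w) * m1 - c := by simp only [hm1, hm2]; linear_combination -c * hd
  have C2 : m1 * y + m2 * w = (x + w) * m2 - a := by simp only [hm1, hm2]; linear_combination -a * hd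
  have C3 : m3 * x + m4 * z = (x + w) * m3 - b := by simp only [hm3, hm4]; linear_combination -b * hd
  have C4 : m3 * y + m4 * w = (x + w) * m4 + c := by simp only [hm3, hm4]; linear_combination c * hd
  -- n = g n g = u m g
  have N1 : u * (m1 * x + m2 * z) = c := by
    rw [← G1]; linear_combination (-x) * E1 - z * E2 - x * hm1 - y * hm3
  have N2 : u * (m1 * y + m2 * w) = a := by
    rw [← G2]; linear_combination (-y) * E1 - w * E2 - x * hm2 - y * hm4
  have N3 : u * (m3 * x + m4 * z) = b := by
    rw [← G3]; linear_combination (-x) * E3 - z * E4 - z * hm1 - w * hm3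
  have N4 : u * (m3 * y + m4 * w) = -c := by
    rw [← G4]; linear_combination (-y) * E3 - w * E4 - z * hm2 - w * hm4
  rw [C1] at N1
  rw [C2] at N2
  rw [C3] at N3
  rw [C4] at N4
  have hu0 : u ≠ 0 := by
    rintro rfl
    exact h ⟨by linarith, by linarith, by linarith⟩
  obtain ⟨v, hv⟩ : ∃ v : ℚ, v * (u * (x + w)) = 1 + u := ⟨(1 + u) / (u * (x + w)), by field_simp⟩
  have hne : u * ((x : ℚ) + w) ≠ 0 := mul_ne_zero hu0 hτ
  have M1 : m1 = v * c := mul_left_cancel₀ hne (by linear_combination N1 - c * hv)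
  have M2 : m2 = v * a := mul_left_cancel₀ hne (by linear_combination N2 - a * hv)
  have M3 : m3 = v * b := mul_left_cancel₀ hne (by linear_combination N3 - b * hv)
  have M4 : m4 = v * -c := mul_left_cancel₀ hne (by linear_combination N4 + c * hv)
  have hq : v ^ 2 - ((x + w : ℤ) : ℚ) * v + 1 = 0 := by
    push_cast
    have q1 : (v ^ 2 - ((x : ℚ) + w) * v + 1) * c = 0 := by
      rw [M1, M2] at C1
      linear_combination C1 + v * hm1 - v * M1
    have q2 : (v ^ 2 - ((x : ℚ) + w) * v + 1) * a = 0 := by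
      rw [M1, M2] at C2
      linear_combination C2 + v * hm2 - v * M2
    have q3 : (v ^ 2 - ((x : ℚ) + w) * v + 1) * b = 0 := by
      rw [M3, M4] at C3
      linear_combination C3 + v * hm3 - v * M3
    by_contra hh
    exact h ⟨by simpa [hh] using q2, by simpa [hh] using q3, by simpa [hh] using q1⟩
  have hv2 : v * v = 1 := by
    rcases aux_root v _ hq with h | h <;> rw [h] <;> norm_num
  have hv0 : v ≠ 0 := by rintro rfl; norm_num at hv2
  have hu1 : (1 - u) ≠ 0 := fun hh => hu (by linarith)
  -- g n = v n
  rw [M1, M3] at G1 G3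
  rw [M2, M4] at G2
  have z1 : (1 - u) * v * c = 0 := by
    rw [M1] at E1; linear_combination (-v) * G1 + (x * c + y * b) * hv2 + E1
  have z2 : (1 - u) * v * a = 0 := by
    rw [M2] at E2; linear_combination (-v) * G2 + (x * a - y * c) * hv2 + E2
  have z3 : (1 - u) * v * b = 0 := by
    rw [M3] at E3; linear_combination (-v) * G3 + (z * c + w * b) * hv2 + E3
  have hh : (1 - u) * v ≠ 0 := mul_ne_zero hu1 hv0
  exact h ⟨by simpa [hh] using z2, by simpa [hh] using z3, by simpa [hh] using z1⟩

lemma sl_ext (A B : SL2Z) (h1 : A.1 0 0 = B.1 0 0) (h2 : A.1 0 1 = B.1 0 1)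
    (h3 : A.1 1 0 = B.1 1 0) (h4 : A.1 1 1 = B.1 1 1) : A = B := by
  ext i j
  fin_cases i <;> fin_cases j <;> assumption

lemma sl_det (A : SL2Z) : A.1 0 0 * A.1 1 1 - A.1 0 1 * A.1 1 0 = 1 := by
  have := A.2
  rwa [Matrix.det_fin_two] at this

lemma sl_mul (A B : SL2Z) :
    (A * B).1 0 0 = A.1 0 0 * B.1 0 0 + A.1 0 1 * B.1 1 0 ∧
    (A * B).1 0 1 = A.1 0 0 * B.1 0 1 + A.1 0 1 * B.1 1 1 ∧
    (A * B).1 1 0 = A.1 1 0 * B.1 0 0 + A.1 1 1 * B.1 1 0 ∧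
    (A * B).1 1 1 = A.1 1 0 * B.1 0 1 + A.1 1 1 * B.1 1 1 := by
  refine ⟨?_, ?_, ?_, ?_⟩ <;> simp [Matrix.mul_apply, Fin.sum_univ_two]

lemma sl_inv (A : SL2Z) :
    (A⁻¹).1 0 0 = A.1 1 1 ∧ (A⁻¹).1 0 1 = -A.1 0 1 ∧
    (A⁻¹).1 1 0 = -A.1 1 0 ∧ (A⁻¹).1 1 1 = A.1 0 0 := by
  refine ⟨?_, ?_, ?_, ?_⟩ <;> simp [Matrix.SpecialLinearGroup.coe_inv, Matrix.adjugate_fin_two]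

lemma sl_comm_iff (A B : SL2Z) : A * B = B * A ↔
    A.1 0 1 * B.1 1 0 = B.1 0 1 * A.1 1 0 ∧
    A.1 0 1 * (B.1 0 0 - B.1 1 1) = B.1 0 1 * (A.1 0 0 - A.1 1 1) ∧
    A.1 1 0 * (B.1 0 0 - B.1 1 1) = B.1 1 0 * (A.1 0 0 - A.1 1 1) := by
  obtain ⟨a1, a2, a3, a4⟩ := sl_mul A B
  obtain ⟨b1, b2, b3, b4⟩ := sl_mul B A
  constructor
  · intro h
    rw [h] at a1 a2 a3 a4
    rw [b1] at a1
    rw [b2] at a2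
    rw [b3] at a3
    refine ⟨by linarith, by linarith, by linarith⟩
  · rintro ⟨h1, h2, h3⟩
    apply sl_ext
    · rw [a1, b1]; linarith
    · rw [a2, b2]; linarith
    · rw [a3, b3]; linarith
    · rw [a4, b4]; linarith

def TF (G : Subgroup SL2Z) : Prop := ∀ T ∈ G, ∀ m : ℕ, 1 ≤ m → T ^ m = 1 → T = 1

lemma sl_one : (1 : SL2Z).1 0 0 = 1 ∧ (1 : SL2Z).1 0 1 = 0 ∧ (1 : SL2Z).1 1 0 = 0 ∧
    (1 : SL2Z).1 1 1 = 1 := by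
  refine ⟨?_, ?_, ?_, ?_⟩ <;> simp

lemma sl_ne_one_of_tr (A : SL2Z) (h : A.1 0 0 + A.1 1 1 ≠ 2) : A ≠ 1 := by
  rintro rfl
  simp at h

lemma sl_sq (A : SL2Z) : 
    (A ^ 2).1 0 0 = (A.1 0 0 + A.1 1 1) * A.1 0 0 - 1 ∧
    (A ^ 2).1 0 1 = (A.1 0 0 + A.1 1 1) * A.1 0 1 ∧
    (A ^ 2).1 1 0 = (A.1 0 0 + A.1 1 1) * A.1 1 0 ∧
    (A ^ 2).1 1 1 = (A.1 0 0 + A.1 1 1) * A.1 1 1 - 1 := by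
  have h := sl_mul A A
  have d := sl_det A
  rw [← sq] at h
  obtain ⟨h1, h2, h3, h4⟩ := h
  refine ⟨?_, ?_, ?_, ?_⟩
  · rw [h1]; linarith
  · rw [h2]; ring
  · rw [h3]; ring
  · rw [h4]; linarith

lemma negone_sq (A : SL2Z) (h1 : A.1 0 0 = -1) (h2 : A.1 0 1 = 0)
    (h3 : A.1 1 0 = 0) (h4 : A.1 1 1 = -1) : A ^ 2 = 1 := by
  obtain ⟨a1, a2, a3, a4⟩ := sl_sq A
  apply sl_ext
  · rw [a1, h1, h4, sl_one.1]; norm_num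
  · rw [a2, h2, sl_one.2.1]; norm_num
  · rw [a3, h3, sl_one.2.2.1]; norm_num
  · rw [a4, h1, h4, sl_one.2.2.2]; norm_num

lemma tf_negone {G : Subgroup SL2Z} (hG : TF G) (A : SL2Z) (hA : A ∈ G) (h1 : A.1 0 0 = -1)
    (h2 : A.1 0 1 = 0) (h3 : A.1 1 0 = 0) (h4 : A.1 1 1 = -1) : False := by
  have := hG A hA 2 (by norm_num) (negone_sq A h1 h2 h3 h4)
  rw [this] at h1
  simp at h1

lemma tf_tr {G : Subgroup SL2Z} (hG : TF G) (A : SL2Z) (hA : A ∈ G) :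
    2 ≤ |A.1 0 0 + A.1 1 1| := by
  by_contra! hlt
  obtain ⟨a1, a2, a3, a4⟩ := sl_sq A
  have d := sl_det A
  have hne : A ≠ 1 := sl_ne_one_of_tr A (by intro h; rw [h] at hlt; norm_num at hlt)
  obtain ⟨b1, b2, b3, b4⟩ := sl_mul A (A ^ 2)
  rw [← pow_succ'] at b1 b2 b3 b4
  rw [a1, a3] at b1
  rw [a2, a4] at b2
  rw [a1, a3] at b3
  rw [a2, a4] at b4
  have hc : A.1 0 0 + A.1 1 1 = 0 ∨ A.1 0 0 + A.1 1 1 = 1 ∨ A.1 0 0 + A.1 1 1 = -1 := by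
    rw [abs_lt] at hlt; omega
  rcases hc with h | h | h
  · rw [h] at a1 a2 a3 a4
    exact tf_negone hG (A ^ 2) (G.pow_mem hA 2) (by linarith) (by linarith) (by linarith) (by linarith)
  · rw [h] at b1 b2 b3 b4
    have hw : A.1 1 1 = 1 - A.1 0 0 := by linarith
    rw [hw] at d b2 b3 b4
    exact tf_negone hG (A ^ 3) (G.pow_mem hA 3) (by linarith) (by linarith) (by linarith) (by linarith)
  · rw [h] at b1 b2 b3 b4
    have hw : A.1 1 1 = -1 - A.1 0 0 := by linarith
    rw [hw] at d b2 b3 b4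
    refine hne (hG A hA 3 (by norm_num) ?_)
    apply sl_ext
    · rw [sl_one.1]; linarith
    · rw [sl_one.2.1]; linarith
    · rw [sl_one.2.2.1]; linarith
    · rw [sl_one.2.2.2]; linarith

lemma tf_nonscalar {G : Subgroup SL2Z} (hG : TF G) (A : SL2Z) (hA : A ∈ G) (hne : A ≠ 1) :
    ¬ (A.1 0 1 = 0 ∧ A.1 1 0 = 0 ∧ A.1 0 0 - A.1 1 1 = 0) := by
  rintro ⟨h1, h2, h3⟩
  have d := sl_det A
  have h4 : A.1 1 1 = A.1 0 0 := by linarith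
  rw [h1, h4] at d
  have h5 : A.1 0 0 * A.1 0 0 = 1 := by linarith
  rcases Int.eq_one_or_neg_one_of_mul_eq_one h5 with h | h
  · refine hne (sl_ext _ _ ?_ ?_ ?_ ?_) <;> simp [h1, h2, h4, h]
  · exact tf_negone hG A hA h h1 h2 (by rw [h4, h])

/-- proportionality of traceless parts -/
lemma comm_prop (A B : SL2Z) (hA : ¬ (A.1 0 1 = 0 ∧ A.1 1 0 = 0 ∧ A.1 0 0 - A.1 1 1 = 0))
    (h : A * B = B * A) : ∃ u : ℚ, (B.1 0 1 : ℚ) = u * A.1 0 1 ∧ (B.1 1 0 : ℚ) = u * A.1 1 0 ∧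
      ((B.1 0 0 : ℚ) - B.1 1 1) = u * (A.1 0 0 - A.1 1 1) := by
  obtain ⟨h1, h2, h3⟩ := (sl_comm_iff A B).mp h
  apply aux_prop
  · exact_mod_cast hA
  · exact_mod_cast h1
  · exact_mod_cast h2
  · exact_mod_cast h3

lemma comm_trans (A B C : SL2Z) (hA : ¬ (A.1 0 1 = 0 ∧ A.1 1 0 = 0 ∧ A.1 0 0 - A.1 1 1 = 0))
    (h : A * B = B * A) (h' : A * C = C * A) : B * C = C * B := by
  obtain ⟨u, u1, u2, u3⟩ := comm_prop A B hA h
  obtain ⟨v, v1, v2, v3⟩ := comm_prop A C hA h'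
  rw [sl_comm_iff]
  refine ⟨?_, ?_, ?_⟩
  · have : (B.1 0 1 : ℚ) * C.1 1 0 = C.1 0 1 * B.1 1 0 := by rw [u1, u2, v1, v2]; ring
    exact_mod_cast this
  · have : (B.1 0 1 : ℚ) * (C.1 0 0 - C.1 1 1) = C.1 0 1 * (B.1 0 0 - B.1 1 1) := by
      rw [u1, u3, v1, v3]; ring
    exact_mod_cast this
  · have : (B.1 1 0 : ℚ) * (C.1 0 0 - C.1 1 1) = C.1 1 0 * (B.1 0 0 - B.1 1 1) := by
      rw [u2, u3, v2, v3]; ring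
    exact_mod_cast this

lemma conj_comm {G : Subgroup SL2Z} (hG : TF G) (A g : SL2Z) (hA : A ∈ G) (hne : A ≠ 1)
    (hg : g ∈ G) (h : A * (g * A * g⁻¹) = (g * A * g⁻¹) * A) : A * g = g * A := by
  have hns := tf_nonscalar hG A hA hne
  obtain ⟨B, hB⟩ : ∃ B, B = g * A * g⁻¹ := ⟨_, rfl⟩
  rw [← hB] at h
  have hBg : B * g = g * A := by rw [hB]; group
  obtain ⟨u, u1, u2, u3⟩ := comm_prop A B hns h
  have d := sl_det g
  have htr : B.1 0 0 + B.1 1 1 = A.1 0 0 + A.1 1 1 := by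
    obtain ⟨i1, i2, i3, i4⟩ := sl_inv g
    obtain ⟨a1, a2, a3, a4⟩ := sl_mul (g * A) g⁻¹
    obtain ⟨b1, b2, b3, b4⟩ := sl_mul g A
    rw [hB, a1, a4, b1, b2, b3, b4, i1, i2, i3, i4]
    linear_combination (A.1 0 0 + A.1 1 1) * d
  obtain ⟨a1, a2, a3, a4⟩ := sl_mul B g
  obtain ⟨b1, b2, b3, b4⟩ := sl_mul g A
  rw [hBg] at a1 a2 a3 a4
  rw [b1] at a1
  rw [b2] at a2
  rw [b3] at a3
  rw [b4] at a4
  have ht : g.1 0 0 + g.1 1 1 ≠ 0 := by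
    intro h0
    have := tf_tr hG g hg
    rw [h0] at this
    norm_num at this
  have htr' : (B.1 0 0 : ℚ) + B.1 1 1 = A.1 0 0 + A.1 1 1 := by exact_mod_cast htr
  have q1 := congrArg (Int.cast : ℤ → ℚ) a1
  have q2 := congrArg (Int.cast : ℤ → ℚ) a2
  have q3 := congrArg (Int.cast : ℤ → ℚ) a3
  have q4 := congrArg (Int.cast : ℤ → ℚ) a4
  push_cast at q1 q2 q3 q4
  have hu : u = 1 := by
    refine aux_key (g.1 0 0) (g.1 0 1) (g.1 1 0) (g.1 1 1) d ht (A.1 0 1) (A.1 1 0)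
      ((A.1 0 0 - A.1 1 1) / 2) u ?_ ?_ ?_ ?_ ?_
    · rintro ⟨h1, h2, h3⟩
      apply hns
      refine ⟨by exact_mod_cast h1, by exact_mod_cast h2, ?_⟩
      have : (A.1 0 0 : ℚ) - A.1 1 1 = 0 := by linarith
      exact_mod_cast this
    · linear_combination q1 + (g.1 0 0 : ℚ) / 2 * u3 + (g.1 1 0 : ℚ) * u1 + (g.1 0 0 : ℚ) / 2 * htr'
    · linear_combination q2 + (g.1 0 1 : ℚ) / 2 * u3 + (g.1 1 1 : ℚ) * u1 + (g.1 0 1 : ℚ) / 2 * htr'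
    · linear_combination q3 - (g.1 1 0 : ℚ) / 2 * u3 + (g.1 0 0 : ℚ) * u2 + (g.1 1 0 : ℚ) / 2 * htr'
    · linear_combination q4 - (g.1 1 1 : ℚ) / 2 * u3 + (g.1 0 1 : ℚ) * u2 + (g.1 1 1 : ℚ) / 2 * htr'
  rw [hu] at u1 u2 u3
  have hBA : B = A := by
    apply sl_ext
    · have : (B.1 0 0 : ℚ) = A.1 0 0 := by linarith
      exact_mod_cast this
    · rw [one_mul] at u1; exact_mod_cast u1
    · rw [one_mul] at u2; exact_mod_cast u2
    · have : (B.1 1 1 : ℚ) = A.1 1 1 := by linarith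
      exact_mod_cast this
  rw [← hBg, hBA]

def size (A : SL2Z) : ℕ := (A.1 0 1).natAbs + (A.1 1 0).natAbs + (A.1 0 0 - A.1 1 1).natAbs

lemma size_cast (A : SL2Z) : (size A : ℚ) =
    |(A.1 0 1 : ℚ)| + |(A.1 1 0 : ℚ)| + |(A.1 0 0 : ℚ) - A.1 1 1| := by
  simp [size, Nat.cast_natAbs]

lemma size_pos {G : Subgroup SL2Z} (hG : TF G) (A : SL2Z) (hA : A ∈ G) (hne : A ≠ 1) :
    0 < size A := by
  have := tf_nonscalar hG A hA hne
  unfold size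
  omega

lemma size_u (A B : SL2Z) (u : ℚ) (h1 : (B.1 0 1 : ℚ) = u * A.1 0 1)
    (h2 : (B.1 1 0 : ℚ) = u * A.1 1 0) (h3 : ((B.1 0 0 : ℚ) - B.1 1 1) = u * (A.1 0 0 - A.1 1 1)) :
    (size B : ℚ) = |u| * size A := by
  rw [size_cast, size_cast, h1, h2, h3, abs_mul, abs_mul, abs_mul]; ring

/-- The real inequality behind the descent. -/
lemma aux_ineq (T t u : ℚ) (hT : 2 ≤ |T|) (hu : 1 ≤ |u|)
    (h : t ^ 2 - 4 = (T ^ 2 - 4) * u ^ 2) :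
    |T * u - t| / 2 < |u| ∨ |T * u + t| / 2 < |u| := by
  have key : abs (|T| * |u| - |t|) < 2 * |u| := by
    have h' : |t| ^ 2 - 4 = (|T| ^ 2 - 4) * |u| ^ 2 := by simpa [sq_abs] using h
    have ht := abs_nonneg t
    generalize |t| = t at *
    generalize |T| = T at *
    generalize |u| = u at *
    rw [abs_lt]
    constructor
    · have : t ≤ T * u := by
        apply le_of_sq_le_sq _ (by positivity)
        nlinarith
      linarith
    · have : (T - 2) * u < t := by
        apply lt_of_pow_lt_pow_left₀ 2 ht
        nlinarith [mul_nonneg (sub_nonneg.mpr hT) (sq_nonneg u)]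
      linarith
  rw [← abs_mul] at key
  rcases abs_cases (T * u) with ⟨h1, _⟩ | ⟨h1, _⟩ <;> rcases abs_cases t with ⟨h2, _⟩ | ⟨h2, _⟩ <;>
    rw [h1, h2] at key
  · left; linarith
  · right
    rw [sub_neg_eq_add] at key; linarith
  · right
    rw [show -(T * u) - t = -(T * u + t) by ring, abs_neg] at key; linarith
  · left
    rw [show -(T * u) - -t = -(T * u - t) by ring, abs_neg] at key; linarith

lemma descent {G : Subgroup SL2Z} (hG : TF G) (A B : SL2Z) (hA : A ∈ G) (hAne : A ≠ 1)
    (hc : A * B = B * A) (hs : size A ≤ size B) :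
    size (B * A⁻¹) < size B ∨ size (B * A) < size B := by
  obtain ⟨u, u1, u2, u3⟩ := comm_prop A B (tf_nonscalar hG A hA hAne) hc
  have hsz := size_u A B u u1 u2 u3
  have hpos : (0 : ℚ) < size A := by exact_mod_cast size_pos hG A hA hAne
  have hu : 1 ≤ |u| := by
    have : (size A : ℚ) ≤ size B := by exact_mod_cast hs
    rw [hsz] at this
    exact le_of_mul_le_mul_right (by linarith) hpos
  have hT : (2 : ℚ) ≤ |(A.1 0 0 : ℚ) + A.1 1 1| := by exact_mod_cast tf_tr hG A hA
  have dA : (A.1 0 0 : ℚ) * A.1 1 1 - A.1 0 1 * A.1 1 0 = 1 := by exact_mod_cast sl_det A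
  have dB : (B.1 0 0 : ℚ) * B.1 1 1 - B.1 0 1 * B.1 1 0 = 1 := by exact_mod_cast sl_det B
  have hrel : ((B.1 0 0 : ℚ) + B.1 1 1) ^ 2 - 4 = (((A.1 0 0 : ℚ) + A.1 1 1) ^ 2 - 4) * u ^ 2 := by
    have e1 : ((B.1 0 0 : ℚ) + B.1 1 1) ^ 2 - 4 =
      (B.1 0 0 - B.1 1 1) ^ 2 + 4 * (B.1 0 1 * B.1 1 0) := by linear_combination 4 * dB
    have e2 : ((A.1 0 0 : ℚ) + A.1 1 1) ^ 2 - 4 =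
      (A.1 0 0 - A.1 1 1) ^ 2 + 4 * (A.1 0 1 * A.1 1 0) := by linear_combination 4 * dA
    rw [e1, e2, u1, u2, u3]; ring
  obtain ⟨i1, i2, i3, i4⟩ := sl_inv A
  have fin : ∀ C : SL2Z, ∀ v : ℚ, |v| / 2 < |u| → (C.1 0 1 : ℚ) = v / 2 * A.1 0 1 →
      (C.1 1 0 : ℚ) = v / 2 * A.1 1 0 → ((C.1 0 0 : ℚ) - C.1 1 1) = v / 2 * (A.1 0 0 - A.1 1 1) →
      size C < size B := by
    intro C v hv h1 h2 h3
    have := size_u A C (v / 2) h1 h2 h3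
    have h4 : (size C : ℚ) < size B := by
      rw [this, hsz, abs_div, abs_two]
      exact mul_lt_mul_of_pos_right hv hpos
    exact_mod_cast h4
  rcases aux_ineq _ _ _ hT hu hrel with hlt | hlt
  · left
    obtain ⟨a1, a2, a3, a4⟩ := sl_mul B A⁻¹
    refine fin _ _ hlt ?_ ?_ ?_
    · rw [a2, i2, i4]; push_cast
      linear_combination (A.1 0 0 + A.1 1 1 : ℚ) / 2 * u1 + (A.1 0 0 - A.1 1 1 : ℚ) / 2 * u1 - (A.1 0 1 : ℚ) / 2 * u3
    · rw [a3, i1, i3]; push_cast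
      linear_combination (A.1 0 0 + A.1 1 1 : ℚ) / 2 * u2 - (A.1 0 0 - A.1 1 1 : ℚ) / 2 * u2 + (A.1 1 0 : ℚ) / 2 * u3
    · rw [a1, a4, i1, i2, i3, i4]; push_cast
      linear_combination (A.1 0 0 + A.1 1 1 : ℚ) / 2 * u3 + (A.1 0 1 : ℚ) * u2 - (A.1 1 0 : ℚ) * u1
  · right
    obtain ⟨a1, a2, a3, a4⟩ := sl_mul B A
    refine fin _ _ hlt ?_ ?_ ?_
    · rw [a2]; push_cast
      linear_combination (A.1 1 1 : ℚ) * u1 + (A.1 0 1 : ℚ) / 2 * u3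
    · rw [a3]; push_cast
      linear_combination (A.1 0 0 : ℚ) * u2 - (A.1 1 0 : ℚ) / 2 * u3
    · rw [a1, a4]; push_cast
      linear_combination (A.1 0 0 + A.1 1 1 : ℚ) / 2 * u3 - (A.1 0 1 : ℚ) * u2 + (A.1 1 0 : ℚ) * u1

lemma cyclic_of_comm {G : Subgroup SL2Z} (hG : TF G) (hc : ∀ A ∈ G, ∀ B ∈ G, A * B = B * A)
    (hne : ∃ A ∈ G, A ≠ 1) : ∃ A ∈ G, A ≠ 1 ∧ G = Subgroup.zpowers A := by
  classical
  have hex : ∃ n, ∃ A ∈ G, A ≠ 1 ∧ size A = n := by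
    obtain ⟨A, h1, h2⟩ := hne
    exact ⟨_, A, h1, h2, rfl⟩
  obtain ⟨A, hA, hA1, hAs⟩ := Nat.find_spec hex
  have hmin : ∀ B ∈ G, B ≠ 1 → size A ≤ size B := fun B hB hB1 => by
    rw [hAs]; exact Nat.find_min' hex ⟨B, hB, hB1, rfl⟩
  refine ⟨A, hA, hA1, le_antisymm ?_ (by simpa using hA)⟩
  have : ∀ n : ℕ, ∀ B ∈ G, size B = n → B ∈ Subgroup.zpowers A := by
    intro n
    induction n using Nat.strong_induction_on with
    | _ n ih =>
      intro B hB hn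
      by_cases hB1 : B = 1
      · rw [hB1]; exact one_mem _
      have hAz : A ∈ Subgroup.zpowers A := Subgroup.mem_zpowers A
      rcases descent hG A B hA hA1 (hc A hA B hB) (hmin B hB hB1) with h | h
      · have := ih _ (hn ▸ h) _ (mul_mem hB (inv_mem hA)) rfl
        simpa using mul_mem this hAz
      · have := ih _ (hn ▸ h) _ (mul_mem hB hA) rfl
        simpa using mul_mem this (inv_mem hAz)
  exact fun B hB => this _ B hB rfl

open scoped commutatorElement in
lemma exists_abelian_normal {Γ : Type*} [Group Γ] (h : ∃ H : Subgroup Γ, IsSolvable H ∧ H.FiniteIndex)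
    (hinf : Infinite Γ) : ∃ M : Subgroup Γ, M.Normal ∧ M ≠ ⊥ ∧ ∀ a ∈ M, ∀ b ∈ M, a * b = b * a := by
  classical
  obtain ⟨H, hs, hf⟩ := h
  let N := H.normalCore
  have hs' : Group.IsSolvable H := hs
  have hNs : Group.IsSolvable N :=
    Group.isSolvable_of_isSolvable_injective (Subgroup.inclusion_injective (Subgroup.normalCore_le H))
  have hNf : N.FiniteIndex := inferInstanceAs H.normalCore.FiniteIndex
  have hNn : N.Normal := inferInstanceAs H.normalCore.Normal
  have hNbot : N ≠ ⊥ := by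
    intro hb
    have hi := hNf.index_ne_zero
    rw [hb, Subgroup.index_bot] at hi
    exact hi (Nat.card_eq_zero_of_infinite)
  have hex : ∃ n, derivedSeries N n = ⊥ := (Group.isSolvable_def N).mp hNs
  have h0 : Nat.find hex ≠ 0 := by
    intro h0
    have := Nat.find_spec hex
    rw [h0, derivedSeries_zero] at this
    apply hNbot
    rw [eq_bot_iff]
    intro x hx
    have : (⟨x, hx⟩ : N) ∈ (⊤ : Subgroup N) := trivial
    rw [‹(⊤ : Subgroup N) = ⊥›] at this
    simpa [Subtype.ext_iff] using Subgroup.mem_bot.mp this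
  obtain ⟨k, hk⟩ := Nat.exists_eq_succ_of_ne_zero h0
  have hk1 : derivedSeries N k ≠ ⊥ := Nat.find_min hex (by omega)
  have hk2 : derivedSeries N (k + 1) = ⊥ := by have := Nat.find_spec hex; rwa [hk] at this
  refine ⟨(derivedSeries N k).map N.subtype, inferInstance, ?_, ?_⟩
  · intro hb
    exact hk1 ((Subgroup.map_eq_bot_iff_of_injective _ N.subtype_injective).mp hb)
  · rintro _ ⟨a, ha, rfl⟩ _ ⟨b, hb, rfl⟩
    rw [derivedSeries_succ] at hk2
    have : ⁅a, b⁆ ∈ (⊥ : Subgroup N) := hk2 ▸ Subgroup.commutator_mem_commutator ha hb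
    rw [Subgroup.mem_bot, commutatorElement_eq_one_iff_mul_comm] at this
    rw [← map_mul, this, map_mul]

lemma main_cyclic (G : Subgroup SL2Z)
    (hvs : ∃ H : Subgroup G, IsSolvable H ∧ H.FiniteIndex) (hG : TF G) (hne : G ≠ ⊥) :
    ∃ A ∈ G, A ≠ 1 ∧ G = Subgroup.zpowers A := by
  have hne' : ∃ A ∈ G, A ≠ 1 := by
    by_contra! hh
    exact hne ((Subgroup.eq_bot_iff_forall G).mpr hh)
  have hinf : Infinite G := by
    by_contra hfin
    rw [not_infinite_iff_finite] at hfin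
    obtain ⟨A, hA, hA1⟩ := hne'
    have hp := pow_card_eq_one' (x := (⟨A, hA⟩ : G))
    refine hA1 (hG A hA (Nat.card G) Nat.card_pos ?_)
    exact congrArg Subtype.val hp
  obtain ⟨M, hMn, hMb, hMc⟩ := exists_abelian_normal hvs hinf
  obtain ⟨⟨⟨a, haG⟩, haM⟩, ha0⟩ := Subgroup.ne_bot_iff_exists_ne_one.mp hMb
  have ha1 : (⟨a, haG⟩ : G) ≠ 1 := fun h => ha0 (Subtype.ext h)
  have ha1' : a ≠ 1 := fun h => ha1 (Subtype.ext h)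
  have hcen : ∀ g ∈ G, a * g = g * a := by
    intro g hg
    refine conj_comm hG a g haG ha1' hg ?_
    have := hMc _ haM _ (hMn.conj_mem _ haM ⟨g, hg⟩)
    simpa [Subtype.ext_iff] using this
  exact cyclic_of_comm hG (fun A hA B hB =>
    comm_trans a A B (tf_nonscalar hG a haG ha1') (hcen A hA) (hcen B hB)) hne'

lemma tf_inj {G : Subgroup SL2Z} (hG : TF G) (A : SL2Z) (hA : A ∈ G) (hA1 : A ≠ 1) :
    Function.Injective fun n : ℤ => A ^ n := by
  rw [injective_zpow_iff_not_isOfFinOrder, isOfFinOrder_iff_pow_eq_one]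
  rintro ⟨n, hn, h⟩
  exact hA1 (hG A hA n hn h)

lemma sl_trace (A : SL2Z) : Matrix.trace (A : Matrix (Fin 2) (Fin 2) ℤ) = A.1 0 0 + A.1 1 1 :=
  Matrix.trace_fin_two _

lemma inf_not_bot {G : Subgroup SL2Z} {P : SL2Z → Prop} (h : IsInfiniteCyclicWithGenerator G P) :
    G ≠ ⊥ := by
  obtain ⟨A, _, rfl, hi⟩ := h
  intro hb
  rw [Subgroup.zpowers_eq_bot] at hb
  have : (1 : ℤ) = 0 := hi (by simp [hb])
  omega

lemma inf_tf {G : Subgroup SL2Z} {P : SL2Z → Prop} (h : IsInfiniteCyclicWithGenerator G P) :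
    ¬ (∃ T ∈ G, T ≠ 1 ∧ ∃ m : ℕ, 1 ≤ m ∧ T ^ m = 1) := by
  obtain ⟨A, _, rfl, hi⟩ := h
  rintro ⟨T, ⟨k, rfl⟩, hT, m, hm, h1⟩
  have : k * m = 0 := hi (by simpa [zpow_mul] using h1)
  rcases mul_eq_zero.mp this with h | h
  · simp [h] at hT
  · omega

lemma inf_trace {G : Subgroup SL2Z} {P Q : SL2Z → Prop} (h : IsInfiniteCyclicWithGenerator G P)
    (h' : IsInfiniteCyclicWithGenerator G Q) : ∃ A B : SL2Z, P A ∧ Q B ∧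
      Matrix.trace (A : Matrix (Fin 2) (Fin 2) ℤ) = Matrix.trace (B : Matrix (Fin 2) (Fin 2) ℤ) := by
  obtain ⟨A, hA, rfl, hi⟩ := h
  obtain ⟨B, hB, hG, hj⟩ := h'
  refine ⟨A, B, hA, hB, ?_⟩
  obtain ⟨k, hk⟩ : B ∈ Subgroup.zpowers A := hG ▸ Subgroup.mem_zpowers B
  obtain ⟨l, hl⟩ : A ∈ Subgroup.zpowers B := hG ▸ Subgroup.mem_zpowers A
  dsimp only at hk hl
  have : k * l = 1 := hi (by simp only [zpow_mul, hk, hl, zpow_one])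
  rcases Int.eq_one_or_neg_one_of_mul_eq_one this with h | h
  · rw [h, zpow_one] at hk; rw [hk]
  · rw [h, zpow_neg_one] at hk
    rw [← hk, sl_trace, sl_trace, (sl_inv A).1, (sl_inv A).2.2.2, add_comm]

lemma six_props (p0 p1 p2 p3 p4 p5 : Prop) (ex : p0 ∨ p1 ∨ p2 ∨ p3 ∨ p4 ∨ p5)
    (e01 : p0 → ¬ p1) (e02 : p2 → ¬ p0) (e03 : p3 → ¬ p0) (e04 : p4 → ¬ p0) (e05 : p5 → ¬ p0)
    (e12 : p2 → ¬ p1) (e13 : p3 → ¬ p1) (e14 : p4 → ¬ p1) (e15 : p5 → ¬ p1)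
    (e23 : p2 → ¬ p3) (e24 : p2 → ¬ p4) (e25 : p2 → ¬ p5) (e34 : p3 → ¬ p4) (e35 : p3 → ¬ p5)
    (e45 : p4 → ¬ p5) : ∃! c : Fin 6, (![p0, p1, p2, p3, p4, p5] : Fin 6 → Prop) c := by
  have ex' : ∃ c : Fin 6, (![p0, p1, p2, p3, p4, p5] : Fin 6 → Prop) c := by
    rcases ex with h | h | h | h | h | h
    exacts [⟨0, h⟩, ⟨1, h⟩, ⟨2, h⟩, ⟨3, h⟩, ⟨4, h⟩, ⟨5, h⟩]
  obtain ⟨c, hc⟩ := ex'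
  refine ⟨c, hc, fun d hd => ?_⟩
  fin_cases c <;> fin_cases d <;> first
    | rfl
    | (exfalso; revert hc hd; simpa)
    | (exfalso; revert hc; revert hd; simp only [imp_false]; intro h1 h2; revert h2 h1; simpa)
    | (exfalso; have h1 := hc; clear hc; revert hd h1; simpa)

/-- Let `G` be a virtually solvable subgroup of `SL(2,ℤ)`.  Then
exactly one of the following six conditions holds: (i) `G` is trivial; (ii) `G`
contains a torsion element; (iii)–(vi) `G` is infinite cyclic generated by a twisted
inversion / a shear / an inverting scale / a positive scale. -/
theorem virtually_solvable_subgroup_sl2z_six_cases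
    (G : Subgroup SL2Z)
    (hvs : ∃ H : Subgroup G, IsSolvable H ∧ H.FiniteIndex) :
    ∃! c : Fin 6,
      (![G = ⊥,
         (∃ T ∈ G, T ≠ 1 ∧ ∃ m : ℕ, 1 ≤ m ∧ T ^ m = 1),
         IsInfiniteCyclicWithGenerator G IsTwistedInversion,
         IsInfiniteCyclicWithGenerator G IsShear,
         IsInfiniteCyclicWithGenerator G IsInvertingScale,
         IsInfiniteCyclicWithGenerator G IsPositiveScale] : Fin 6 → Prop) c := by
  have e01 : G = ⊥ → ¬ (∃ T ∈ G, T ≠ 1 ∧ ∃ m : ℕ, 1 ≤ m ∧ T ^ m = 1) := by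
    rintro rfl ⟨T, hT, hT1, _⟩
    exact hT1 (Subgroup.mem_bot.mp hT)
  have e0 : ∀ P, IsInfiniteCyclicWithGenerator G P → ¬ G = ⊥ := fun P h => inf_not_bot h
  have e1 : ∀ P, IsInfiniteCyclicWithGenerator G P →
    ¬ (∃ T ∈ G, T ≠ 1 ∧ ∃ m : ℕ, 1 ≤ m ∧ T ^ m = 1) := fun P h => inf_tf h
  have e23 : IsInfiniteCyclicWithGenerator G IsTwistedInversion →
      ¬ IsInfiniteCyclicWithGenerator G IsShear := fun h h' => by
    obtain ⟨A, B, ⟨hA, _⟩, ⟨hB, _⟩, ht⟩ := inf_trace h h'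
    omega
  have e24 : IsInfiniteCyclicWithGenerator G IsTwistedInversion →
      ¬ IsInfiniteCyclicWithGenerator G IsInvertingScale := fun h h' => by
    obtain ⟨A, B, ⟨hA, _⟩, hB, ht⟩ := inf_trace h h'
    unfold IsInvertingScale at hB
    omega
  have e25 : IsInfiniteCyclicWithGenerator G IsTwistedInversion →
      ¬ IsInfiniteCyclicWithGenerator G IsPositiveScale := fun h h' => by
    obtain ⟨A, B, ⟨hA, _⟩, hB, ht⟩ := inf_trace h h'
    unfold IsPositiveScale at hB
    omega
  have e34 : IsInfiniteCyclicWithGenerator G IsShear →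
      ¬ IsInfiniteCyclicWithGenerator G IsInvertingScale := fun h h' => by
    obtain ⟨A, B, ⟨hA, _⟩, hB, ht⟩ := inf_trace h h'
    unfold IsInvertingScale at hB
    omega
  have e35 : IsInfiniteCyclicWithGenerator G IsShear →
      ¬ IsInfiniteCyclicWithGenerator G IsPositiveScale := fun h h' => by
    obtain ⟨A, B, ⟨hA, _⟩, hB, ht⟩ := inf_trace h h'
    unfold IsPositiveScale at hB
    omega
  have e45 : IsInfiniteCyclicWithGenerator G IsInvertingScale →
      ¬ IsInfiniteCyclicWithGenerator G IsPositiveScale := fun h h' => by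
    obtain ⟨A, B, hA, hB, ht⟩ := inf_trace h h'
    unfold IsPositiveScale at hB
    unfold IsInvertingScale at hA
    omega
  have ex : G = ⊥ ∨ (∃ T ∈ G, T ≠ 1 ∧ ∃ m : ℕ, 1 ≤ m ∧ T ^ m = 1) ∨
      IsInfiniteCyclicWithGenerator G IsTwistedInversion ∨
      IsInfiniteCyclicWithGenerator G IsShear ∨
      IsInfiniteCyclicWithGenerator G IsInvertingScale ∨
      IsInfiniteCyclicWithGenerator G IsPositiveScale := by
    by_cases hb : G = ⊥
    · exact Or.inl hb
    by_cases ht : ∃ T ∈ G, T ≠ 1 ∧ ∃ m : ℕ, 1 ≤ m ∧ T ^ m = 1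
    · exact Or.inr (Or.inl ht)
    right; right
    have hG : TF G := by
      intro T hT m hm h
      by_contra hT1
      exact ht ⟨T, hT, hT1, m, hm, h⟩
    obtain ⟨A, hA, hA1, hGA⟩ := main_cyclic G hvs hG hb
    have hi := tf_inj hG A hA hA1
    have htr := tf_tr hG A hA
    rw [← sl_trace, le_abs] at htr
    have hcases : Matrix.trace (A : Matrix (Fin 2) (Fin 2) ℤ) = -2 ∨
      Matrix.trace (A : Matrix (Fin 2) (Fin 2) ℤ) = 2 ∨
      Matrix.trace (A : Matrix (Fin 2) (Fin 2) ℤ) ≤ -3 ∨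
      3 ≤ Matrix.trace (A : Matrix (Fin 2) (Fin 2) ℤ) := by omega
    rcases hcases with h | h | h | h
    · left
      refine ⟨A, ⟨h, fun hn => ?_⟩, hGA, hi⟩
      apply tf_nonscalar hG A hA hA1
      rw [hn]
      simp
    · exact Or.inr (Or.inl ⟨A, ⟨h, hA1⟩, hGA, hi⟩)
    · exact Or.inr (Or.inr (Or.inl ⟨A, h, hGA, hi⟩))
    · exact Or.inr (Or.inr (Or.inr ⟨A, h, hGA, hi⟩))
  exact six_props _ _ _ _ _ _ ex e01 (e0 _) (e0 _) (e0 _) (e0 _) (e1 _) (e1 _) (e1 _) (e1 _)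
    e23 e24 e25 e34 e35 e45
end

section
/- Let G be a virtually solvable subgroup of SL(2,ℤ). Then G is either finite, or it contains a subgroup of finite index that is isomorphic to ℤ. -/
/-- A group with a discrete injective additive function to `ℝ` is cyclic. -/
theorem cyclic_of_discrete {K : Type*} [Group K] (f : K → ℝ)
    (hmul : ∀ x y, f (x * y) = f x + f y) (ε : ℝ) (hε : 0 < ε)
    (hd : ∀ x, |f x| < ε → x = 1) : IsCyclic K := by
  let F : K →* Multiplicative ℝ :=
    MonoidHom.mk' (fun x => Multiplicative.ofAdd (f x)) (fun x y => by rw [hmul]; rfl)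
  have hF : ∀ x, F x = Multiplicative.ofAdd (f x) := fun _ => rfl
  have hinj : Function.Injective F := by
    rw [injective_iff_map_eq_one]
    intro x hx
    apply hd
    have : f x = 0 := hx
    rw [this]; simpa using hε
  obtain ⟨b, hb⟩ := Subgroup.cyclic_of_isolated_one (H := F.range) (a := Multiplicative.ofAdd ε)
    (by exact hε) (by
      rw [Set.disjoint_left]
      rintro y ⟨x, rfl⟩ ⟨h1, h2⟩
      have h1' : 0 < f x := h1
      have h2' : f x < ε := h2
      have := hd x (by rw [abs_of_pos h1']; exact h2')
      subst this
      have h3 : f 1 = 0 := by have := hmul 1 1; simp at this; exact this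
      linarith)
  have : IsCyclic F.range := by
    rw [hb, ← Subgroup.zpowers_eq_closure]; infer_instance
  exact isCyclic_of_surjective (MonoidHom.ofInjective hinj).symm
    (MonoidHom.ofInjective hinj).symm.surjective

theorem q_ne_zero {p q r s : ℤ} (hdet : p * s - q * r = 1) (ht : (p + s) ^ 2 ≠ 4) : q ≠ 0 := by
  rintro rfl
  have : p * s = 1 := by linarith
  rcases Int.mul_eq_one_iff_eq_one_or_neg_one.1 this with ⟨rfl, rfl⟩ | ⟨rfl, rfl⟩ <;> norm_num at ht

theorem hyp_comm {p q r s p' q' r' s' x y z w : ℤ} (hdet : p * s - q * r = 1)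
    (ht : (p + s) ^ 2 ≠ 4) (hdet' : p' * s' - q' * r' = 1) (htr : p' + s' = p + s)
    (hk : x + w ≠ 0)
    (c1 : q * (p' - s') = q' * (p - s)) (c2 : q * r' = q' * r)
    (e1 : x * p + y * r = p' * x + q' * z) (e2 : x * q + y * s = p' * y + q' * w)
    (e3 : z * p + w * r = r' * x + s' * z) (e4 : z * q + w * s = r' * y + s' * w) :
    p' = p ∧ q' = q ∧ r' = r ∧ s' = s := by
  have hq := q_ne_zero hdet ht
  have hD : (p + s) ^ 2 - 4 ≠ 0 := sub_ne_zero.2 ht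
  have h1 : ((p + s) ^ 2 - 4) * (q' ^ 2 - q ^ 2) = 0 := by
    have hA : (p - s) ^ 2 + 4 * q * r = (p + s) ^ 2 - 4 := by linear_combination -4 * hdet
    have hB : (p' - s') ^ 2 + 4 * q' * r' = (p + s) ^ 2 - 4 := by
      linear_combination -4 * hdet' + (p' + s' + p + s) * htr
    have : q ^ 2 * ((p' - s') ^ 2 + 4 * q' * r') = q' ^ 2 * ((p - s) ^ 2 + 4 * q * r) := by
      linear_combination (q * (p' - s') + q' * (p - s)) * c1 + 4 * q * q' * c2
    rw [hA, hB] at this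
    linear_combination -this
  have h2 : q' ^ 2 = q ^ 2 := by
    rcases mul_eq_zero.1 h1 with h | h
    · exact absurd h hD
    · linarith
  rcases sq_eq_sq_iff_eq_or_eq_neg.1 h2 with h | h
  · rw [h] at c1 c2
    have a1 := mul_left_cancel₀ hq c1
    have a2 := mul_left_cancel₀ hq c2
    exact ⟨by linarith, h, a2, by linarith⟩
  · exfalso
    rw [h] at c1 c2
    have a1 : p' - s' = -(p - s) := mul_left_cancel₀ hq (by linarith)
    have a2 : r' = -r := mul_left_cancel₀ hq (by linarith)
    have b1 : p' = s := by linarith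
    have b2 : s' = p := by linarith
    subst b1 b2 a2 h
    have : q * (x + w) = 0 := by linarith
    rcases mul_eq_zero.1 this with h | h
    · exact hq h
    · exact hk h

theorem sq_add_four {t d : ℤ} (h : t ^ 2 - 4 = d ^ 2) : t = 2 ∨ t = -2 := by
  have h1 : (t - d) * (t + d) = 4 := by linear_combination h
  have h2 : (t - d) ∣ 4 := ⟨_, h1.symm⟩
  have h3 : t - d ≤ 4 := Int.le_of_dvd (by norm_num) h2
  have h4 : -(t - d) ≤ 4 := Int.le_of_dvd (by norm_num) ((neg_dvd).2 h2)
  obtain ⟨e, he⟩ : ∃ e, e = t - d := ⟨_, rfl⟩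
  have h5 : t + d = 2 * t - e := by linarith
  rw [h5, ← he] at h1
  rw [← he] at h3 h4
  have : -4 ≤ e := by linarith
  interval_cases e <;> omega

theorem par_comm {m n l m' n' l' x y z w : ℤ} (hn : m ^ 2 + n * l = 0)
    (hne : n ≠ 0 ∨ l ≠ 0)
    (hdet : x * w - y * z = 1) (hk : x + w ≠ -2)
    (c1 : n * m' = n' * m) (c2 : n * l' = n' * l) (c3 : l * m' = l' * m)
    (e1 : x * m + y * l = m' * x + n' * z) (e2 : x * n - y * m = m' * y + n' * w)
    (e3 : z * m + w * l = l' * x - m' * z) (e4 : z * n - w * m = l' * y - m' * w) :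
    m' = m ∧ n' = n ∧ l' = l := by
  by_cases hT : (x - w) * m + y * l + z * n = 0
  · -- `k` preserves the line
    have ht : x + w = 2 := by
      have hsq : ∃ u v : ℤ, v ≠ 0 ∧ u ^ 2 = ((x + w) ^ 2 - 4) * v ^ 2 := by
        by_cases hm : m = 0
        · subst hm
          rcases hne with h | h
          · have hl : l = 0 := by
              rcases mul_eq_zero.1 (show n * l = 0 by linarith) with h' | h'
              · exact absurd h' h
              · exact h'
            subst hl
            have hz : z = 0 := by
              rcases mul_eq_zero.1 (show z * n = 0 by linarith) with h' | h'
              · exact h'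
              · exact absurd h' h
            subst hz
            exact ⟨x - w, 1, one_ne_zero, by linear_combination -4 * hdet⟩
          · have hl : n = 0 := by
              rcases mul_eq_zero.1 (show n * l = 0 by linarith) with h' | h'
              · exact h'
              · exact absurd h' h
            subst hl
            have hz : y = 0 := by
              rcases mul_eq_zero.1 (show y * l = 0 by linarith) with h' | h'
              · exact h'
              · exact absurd h' h
            subst hz
            exact ⟨x - w, 1, one_ne_zero, by linear_combination -4 * hdet⟩
        · refine ⟨2 * z * n + (x - w) * m, m, hm, ?_⟩
          linear_combination 4 * z * n * hT - 4 * y * z * hn - 4 * m ^ 2 * hdet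
      obtain ⟨u, v, hv, huv⟩ := hsq
      have hdvd : v ∣ u := by
        rw [← Int.pow_dvd_pow_iff (n := 2) two_ne_zero]
        exact ⟨(x + w) ^ 2 - 4, by rw [huv]; ring⟩
      obtain ⟨d, rfl⟩ := hdvd
      have : (x + w) ^ 2 - 4 = d ^ 2 := by
        have hv2 : v ^ 2 ≠ 0 := pow_ne_zero 2 hv
        apply mul_left_cancel₀ hv2
        linear_combination -huv
      rcases sq_add_four this with h | h
      · exact h
      · exact absurd h hk
    obtain ⟨g, hg⟩ : ∃ g, g = x - 1 := ⟨_, rfl⟩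
    have hx : x = 1 + g := by linarith
    have hw : w = 1 - g := by linarith
    subst hx hw
    have hg2 : g ^ 2 + y * z = 0 := by linear_combination -hdet
    have k1 : y * m = g * n := by
      have : (y * m - g * n) ^ 2 = 0 := by
        linear_combination y ^ 2 * hn + n ^ 2 * hg2 - y * n * hT
      have := pow_eq_zero_iff (two_ne_zero) |>.1 this
      linarith
    have k2 : z * m = g * l := by
      have : (z * m - g * l) ^ 2 = 0 := by
        linear_combination z ^ 2 * hn + l ^ 2 * hg2 - z * l * hT
      have := pow_eq_zero_iff (two_ne_zero) |>.1 this
      linarith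
    have k3 : y * l = z * n := by
      have : (y * l - z * n) ^ 2 = 0 := by
        linear_combination (y * l + z * n - 2 * g * m) * hT - 4 * y * z * hn + 4 * m ^ 2 * hg2
      have := pow_eq_zero_iff (two_ne_zero) |>.1 this
      linarith
    have f1 : m' * (1 + g) + n' * z = m * (1 + g) + n * z := by linarith
    have f2 : m' * y + n' * (1 - g) = m * y + n * (1 - g) := by linarith
    have f3 : l' * (1 + g) - m' * z = l * (1 + g) - m * z := by linarith
    have f4 : l' * y - m' * (1 - g) = l * y - m * (1 - g) := by linarith
    refine ⟨?_, ?_, ?_⟩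
    · linear_combination (1 - g) * f1 - z * f2 + (m' - m) * hg2
    · linear_combination (1 + g) * f2 - y * f1 + (n' - n) * hg2
    · linear_combination (1 - g) * f3 - z * f4 + (l' - l) * hg2
  · rcases hne with h | h
    · have hnn : n' = n := by
        have : (n' - n) * ((x - w) * m + y * l + z * n) = 0 := by
          linear_combination (-n) * e1 - n * e4 - (x - w) * c1 - y * c2
        rcases mul_eq_zero.1 this with h' | h'
        · linarith
        · exact absurd h' hT
      subst hnn
      exact ⟨mul_left_cancel₀ h c1, rfl, mul_left_cancel₀ h c2⟩
    · have hnn : l' = l := by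
        have : (l' - l) * ((x - w) * m + y * l + z * n) = 0 := by
          linear_combination (-l) * e1 - l * e4 - (x - w) * c3 + z * c2
        rcases mul_eq_zero.1 this with h' | h'
        · linarith
        · exact absurd h' hT
      subst hnn
      exact ⟨mul_left_cancel₀ h c3, mul_right_cancel₀ h (by linarith), rfl⟩

theorem det_eq (a : SL2Z) : a 0 0 * a 1 1 - a 0 1 * a 1 0 = 1 := by
  have := a.2
  rwa [Matrix.det_fin_two] at this

theorem mul_entries (a b : SL2Z) :
    (a * b) 0 0 = a 0 0 * b 0 0 + a 0 1 * b 1 0 ∧ (a * b) 0 1 = a 0 0 * b 0 1 + a 0 1 * b 1 1 ∧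
    (a * b) 1 0 = a 1 0 * b 0 0 + a 1 1 * b 1 0 ∧ (a * b) 1 1 = a 1 0 * b 0 1 + a 1 1 * b 1 1 := by
  simp [Matrix.SpecialLinearGroup.coe_mul, Matrix.mul_apply, Fin.sum_univ_two]

theorem ext_entries {a b : SL2Z} (h1 : a 0 0 = b 0 0) (h2 : a 0 1 = b 0 1) (h3 : a 1 0 = b 1 0)
    (h4 : a 1 1 = b 1 1) : a = b := by
  ext i j
  fin_cases i <;> fin_cases j <;> assumption

theorem trace_gamma {a : SL2Z} (h : a ∈ CongruenceSubgroup.Gamma 3) :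
    ∃ c, a 0 0 + a 1 1 = 2 + 9 * c := by
  rw [CongruenceSubgroup.Gamma_mem] at h
  obtain ⟨h1, h2, h3, h4⟩ := h
  have g1 : (3 : ℤ) ∣ a 0 0 - 1 := by
    have := (ZMod.intCast_zmod_eq_zero_iff_dvd (a 0 0 - 1) 3).1 (by push_cast; rw [h1]; simp)
    exact_mod_cast this
  have g4 : (3 : ℤ) ∣ a 1 1 - 1 := by
    have := (ZMod.intCast_zmod_eq_zero_iff_dvd (a 1 1 - 1) 3).1 (by push_cast; rw [h4]; simp)
    exact_mod_cast this
  have g2 : (3 : ℤ) ∣ a 0 1 := by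
    exact_mod_cast (ZMod.intCast_zmod_eq_zero_iff_dvd (a 0 1) 3).1 h2
  have g3 : (3 : ℤ) ∣ a 1 0 := by
    exact_mod_cast (ZMod.intCast_zmod_eq_zero_iff_dvd (a 1 0) 3).1 h3
  obtain ⟨c1, g1⟩ := g1
  obtain ⟨c2, g2⟩ := g2
  obtain ⟨c3, g3⟩ := g3
  obtain ⟨c4, g4⟩ := g4
  refine ⟨c2 * c3 - c1 * c4, ?_⟩
  have hd := det_eq a
  have e1 : a 0 0 = 1 + 3 * c1 := by linarith
  have e4 : a 1 1 = 1 + 3 * c4 := by linarith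
  rw [e1, e4, g2, g3] at hd
  rw [e1, e4]
  linarith

theorem comm_entries {a b : SL2Z} (h : a * b = b * a) :
    a 0 1 * (b 0 0 - b 1 1) = b 0 1 * (a 0 0 - a 1 1) ∧ a 0 1 * b 1 0 = b 0 1 * a 1 0 ∧
    a 1 0 * (b 0 0 - b 1 1) = b 1 0 * (a 0 0 - a 1 1) := by
  obtain ⟨h1, h2, h3, h4⟩ := mul_entries a b
  obtain ⟨g1, g2, g3, g4⟩ := mul_entries b a
  rw [h] at h1 h2 h3 h4
  refine ⟨?_, ?_, ?_⟩ <;> linarith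

theorem eq_one_of_zero {a : SL2Z} (ht : a 0 0 + a 1 1 = 2) (h1 : a 0 1 = 0) (h2 : a 1 0 = 0) :
    a = 1 := by
  have hd := det_eq a
  have h : a 0 0 = 1 := by
    have : (a 0 0 - 1) ^ 2 = 0 := by
      have e : a 1 1 = 2 - a 0 0 := by linarith
      rw [h1, e] at hd
      linear_combination -hd
    have := pow_eq_zero_iff (two_ne_zero) |>.1 this
    linarith
  apply ext_entries <;> simp [*] <;> linarith

/-- Key commutation: in `Γ(3)`, if `k a k⁻¹` commutes with `a`, then `k` commutes with `a`. -/
theorem key_comm {a b k : SL2Z} (ha : a ∈ CongruenceSubgroup.Gamma 3)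
    (hk : k ∈ CongruenceSubgroup.Gamma 3) (ha1 : a ≠ 1) (hb : k * a = b * k)
    (hab : a * b = b * a) : b = a := by
  obtain ⟨c, hc⟩ := trace_gamma ha
  obtain ⟨d, hd⟩ := trace_gamma hk
  have htr : b 0 0 + b 1 1 = a 0 0 + a 1 1 := by
    have e : b = k * a * k⁻¹ := by rw [hb]; group
    have : Matrix.trace (b : Matrix (Fin 2) (Fin 2) ℤ) = Matrix.trace (a : Matrix (Fin 2) (Fin 2) ℤ) := by
      rw [e, Matrix.SpecialLinearGroup.coe_mul, Matrix.trace_mul_comm,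
        ← Matrix.SpecialLinearGroup.coe_mul]
      rw [show k⁻¹ * (k * a) = a by group]
    simpa [Matrix.trace_fin_two] using this
  obtain ⟨c1, c2, c3⟩ := comm_entries hab
  obtain ⟨h1, h2, h3, h4⟩ := mul_entries k a
  obtain ⟨g1, g2, g3, g4⟩ := mul_entries b k
  rw [hb] at h1 h2 h3 h4
  by_cases ht : (a 0 0 + a 1 1) ^ 2 = 4
  · have ht2 : a 0 0 + a 1 1 = 2 := by
      rcases sq_eq_sq_iff_eq_or_eq_neg.1 (show (a 0 0 + a 1 1) ^ 2 = 2 ^ 2 by linarith) with h | h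
      · exact h
      · omega
    have hs : a 1 1 = 2 - a 0 0 := by linarith
    have hs' : b 1 1 = 2 - b 0 0 := by linarith
    have hda := det_eq a
    rw [hs] at hda
    have hne : a 0 1 ≠ 0 ∨ a 1 0 ≠ 0 := by
      by_contra hcon
      push Not at hcon
      exact ha1 (eq_one_of_zero ht2 hcon.1 hcon.2)
    rw [hs] at h2 h4 c1 c3
    rw [hs'] at g3 g4 c1 c3
    obtain ⟨r1, r2, r3⟩ := par_comm (m := a 0 0 - 1) (n := a 0 1) (l := a 1 0)
      (m' := b 0 0 - 1) (n' := b 0 1) (l' := b 1 0) (x := k 0 0) (y := k 0 1) (z := k 1 0)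
      (w := k 1 1) (by linear_combination -hda) hne (det_eq k) (by omega)
      (by linarith) (by linarith) (by linarith) (by linarith) (by linarith) (by linarith)
      (by linarith)
    exact ext_entries (by linarith) r2 r3 (by linarith)
  · obtain ⟨r1, r2, r3, r4⟩ := hyp_comm (x := k 0 0) (y := k 0 1) (z := k 1 0)
      (w := k 1 1) (det_eq a) ht (det_eq b) htr (by omega) c1 c2
      (by linarith) (by linarith) (by linarith) (by linarith)
    exact ext_entries r1 r2 r3 r4

theorem cyclic_parabolic {K : Type*} [Group K] (f : K →* SL2Z) (hf : Function.Injective f)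
    (hG : ∀ k, f k ∈ CongruenceSubgroup.Gamma 3) (a : SL2Z) (ha1 : a ≠ 1)
    (ht : a 0 0 + a 1 1 = 2) (hc : ∀ k, a * f k = f k * a) : IsCyclic K := by
  have hda := det_eq a
  have hdisc : (a 0 0 - a 1 1) ^ 2 + 4 * a 0 1 * a 1 0 = 0 := by
    linear_combination -4 * hda + (a 0 0 + a 1 1 + 2) * ht
  have hne : a 0 1 ≠ 0 ∨ a 1 0 ≠ 0 := by
    by_contra hcon
    push Not at hcon
    exact ha1 (eq_one_of_zero ht hcon.1 hcon.2)
  have htk : ∀ k, f k 0 0 + f k 1 1 = 2 := by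
    intro k
    obtain ⟨c, hcc⟩ := trace_gamma (hG k)
    obtain ⟨c1, c2, c3⟩ := comm_entries (hc k)
    have hdk := det_eq (f k)
    have h4 : (f k 0 0 + f k 1 1) ^ 2 - 4 = 0 := by
      rcases hne with h | h
      · apply mul_left_cancel₀ (pow_ne_zero 2 h)
        linear_combination (a 0 1 * (f k 0 0 - f k 1 1) + f k 0 1 * (a 0 0 - a 1 1)) * c1 +
          4 * a 0 1 * f k 0 1 * c2 + f k 0 1 ^ 2 * hdisc + 4 * a 0 1 ^ 2 * hdk
      · apply mul_left_cancel₀ (pow_ne_zero 2 h)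
        linear_combination (a 1 0 * (f k 0 0 - f k 1 1) + f k 1 0 * (a 0 0 - a 1 1)) * c3 -
          4 * a 1 0 * f k 1 0 * c2 + f k 1 0 ^ 2 * hdisc + 4 * a 1 0 ^ 2 * hdk
    rcases sq_eq_sq_iff_eq_or_eq_neg.1 (show (f k 0 0 + f k 1 1) ^ 2 = 2 ^ 2 by linarith) with h | h
    · exact h
    · omega
  rcases hne with h | h
  · refine cyclic_of_discrete (fun k => ((f k 0 1 : ℤ) : ℝ)) ?_ 1 one_pos ?_
    · intro k l
      obtain ⟨-, h2, -, -⟩ := mul_entries (f k) (f l)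
      rw [map_mul, h2]
      norm_cast
      obtain ⟨c1, -, -⟩ := comm_entries (hc k)
      obtain ⟨d1, -, -⟩ := comm_entries (hc l)
      have t1 := htk k
      have t2 := htk l
      apply mul_left_cancel₀ (mul_ne_zero two_ne_zero h)
      linear_combination f l 0 1 * c1 - f k 0 1 * d1 + a 0 1 * f l 0 1 * t1 + a 0 1 * f k 0 1 * t2
    · intro k hk
      have h0 : f k 0 1 = 0 := by
        have : |f k 0 1| < 1 := by exact_mod_cast hk
        exact Int.abs_lt_one_iff.1 this
      obtain ⟨-, c2, -⟩ := comm_entries (hc k)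
      rw [h0, zero_mul] at c2
      have h1 := (mul_eq_zero.1 c2).resolve_left h
      apply hf
      rw [map_one]
      exact eq_one_of_zero (htk k) h0 h1
  · refine cyclic_of_discrete (fun k => ((f k 1 0 : ℤ) : ℝ)) ?_ 1 one_pos ?_
    · intro k l
      obtain ⟨-, -, h2, -⟩ := mul_entries (f k) (f l)
      rw [map_mul, h2]
      norm_cast
      obtain ⟨-, -, c1⟩ := comm_entries (hc k)
      obtain ⟨-, -, d1⟩ := comm_entries (hc l)
      have t1 := htk k
      have t2 := htk l
      apply mul_left_cancel₀ (mul_ne_zero two_ne_zero h)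
      linear_combination -f l 1 0 * c1 + f k 1 0 * d1 + a 1 0 * f l 1 0 * t1 + a 1 0 * f k 1 0 * t2
    · intro k hk
      have h0 : f k 1 0 = 0 := by
        have : |f k 1 0| < 1 := by exact_mod_cast hk
        exact Int.abs_lt_one_iff.1 this
      obtain ⟨-, c2, -⟩ := comm_entries (hc k)
      rw [h0, mul_zero] at c2
      have h1 := (mul_eq_zero.1 c2.symm).resolve_right h
      apply hf
      rw [map_one]
      exact eq_one_of_zero (htk k) h1 h0

theorem trace_small {χ : ℝ} {t : ℤ} (h : χ ^ 2 - t * χ + 1 = 0) (hl : abs (Real.log |χ|) < Real.log 2) :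
    t ^ 2 = 4 := by
  have h0 : χ ≠ 0 := by rintro rfl; norm_num at h
  have hpos : 0 < |χ| := abs_pos.2 h0
  rw [abs_lt] at hl
  have h2 : |χ| < 2 := (Real.log_lt_log_iff hpos (by norm_num)).1 hl.2
  have h1 : 1 / 2 < |χ| := by
    rw [← Real.log_lt_log_iff (by norm_num) hpos, one_div, Real.log_inv]; exact hl.1
  have hsq : |χ| ^ 2 = χ ^ 2 := sq_abs χ
  have e : |χ| ^ 2 + 1 = |(t : ℝ)| * |χ| := by
    rw [← abs_mul, show (t : ℝ) * χ = χ ^ 2 + 1 by linarith, hsq]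
    exact (abs_of_pos (by positivity)).symm
  have u1 : |(t : ℝ)| < 3 := by
    by_contra hcon
    push Not at hcon
    nlinarith
  have u2 : 1 < |(t : ℝ)| := by
    by_contra hcon
    push Not at hcon
    nlinarith [sq_nonneg (|χ| - 1)]
  have v1 : |t| < 3 := by exact_mod_cast u1
  have v2 : 1 < |t| := by exact_mod_cast u2
  have : |t| = 2 := by omega
  rw [← sq_abs, this]; norm_num

theorem cyclic_hyperbolic {K : Type*} [Group K] (f : K →* SL2Z) (hf : Function.Injective f)
    (hG : ∀ k, f k ∈ CongruenceSubgroup.Gamma 3) (a : SL2Z)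
    (ht : 4 < (a 0 0 + a 1 1) ^ 2) (hc : ∀ k, a * f k = f k * a) : IsCyclic K := by
  have hda := det_eq a
  have hq : a 0 1 ≠ 0 := q_ne_zero hda (ne_of_gt ht)
  have hqR : (a 0 1 : ℝ) ≠ 0 := by exact_mod_cast hq
  have hdaR : (a 0 0 : ℝ) * a 1 1 - a 0 1 * a 1 0 = 1 := by exact_mod_cast hda
  obtain ⟨μ, hμ⟩ : ∃ μ : ℝ, a 0 1 * μ ^ 2 + (a 0 0 - a 1 1) * μ - a 1 0 = 0 := by
    have htR : (4 : ℝ) < (a 0 0 + a 1 1) ^ 2 := by exact_mod_cast ht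
    have hs := Real.sq_sqrt (show (0 : ℝ) ≤ (a 0 0 + a 1 1) ^ 2 - 4 by linarith)
    set S := √(((a 0 0 : ℝ) + a 1 1) ^ 2 - 4)
    refine ⟨(-(a 0 0 - a 1 1) + S) / (2 * a 0 1), ?_⟩
    field_simp
    linear_combination hs + 4 * hdaR
  have hμk : ∀ k, (f k 0 1 : ℝ) * μ ^ 2 + (f k 0 0 - f k 1 1) * μ - f k 1 0 = 0 := by
    intro k
    obtain ⟨c1, c2, c3⟩ := comm_entries (hc k)
    have c1R : (a 0 1 : ℝ) * (f k 0 0 - f k 1 1) = f k 0 1 * (a 0 0 - a 1 1) := by exact_mod_cast c1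
    have c2R : (a 0 1 : ℝ) * f k 1 0 = f k 0 1 * a 1 0 := by exact_mod_cast c2
    apply mul_left_cancel₀ hqR
    linear_combination (f k 0 1 : ℝ) * hμ + μ * c1R - c2R
  have hchar : ∀ k, ((f k 0 0 : ℝ) + f k 0 1 * μ) ^ 2 -
      ((f k 0 0 + f k 1 1 : ℤ) : ℝ) * ((f k 0 0 : ℝ) + f k 0 1 * μ) + 1 = 0 := by
    intro k
    have hdk : (f k 0 0 : ℝ) * f k 1 1 - f k 0 1 * f k 1 0 = 1 := by exact_mod_cast det_eq (f k)
    push_cast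
    linear_combination (f k 0 1 : ℝ) * hμk k - hdk
  have hne : ∀ k, (f k 0 0 : ℝ) + f k 0 1 * μ ≠ 0 := by
    intro k h
    have := hchar k
    rw [h] at this
    norm_num at this
  refine cyclic_of_discrete (fun k => Real.log |(f k 0 0 : ℝ) + f k 0 1 * μ|) ?_ (Real.log 2)
    (Real.log_pos (by norm_num)) ?_
  · intro k l
    rw [← Real.log_mul (abs_ne_zero.2 (hne k)) (abs_ne_zero.2 (hne l)), ← abs_mul]
    congr 2
    obtain ⟨h1, h2, -, -⟩ := mul_entries (f k) (f l)
    rw [map_mul, h1, h2]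
    push_cast
    linear_combination -(f k 0 1 : ℝ) * hμk l
  · intro k hk
    have h4 := trace_small (hchar k) hk
    obtain ⟨c, hcc⟩ := trace_gamma (hG k)
    have htk : f k 0 0 + f k 1 1 = 2 := by
      rcases sq_eq_sq_iff_eq_or_eq_neg.1 (show (f k 0 0 + f k 1 1) ^ 2 = 2 ^ 2 by linarith) with h | h
      · exact h
      · omega
    obtain ⟨c1, c2, c3⟩ := comm_entries (hc k)
    have hdk := det_eq (f k)
    have h0 : f k 0 1 = 0 := by
      have : f k 0 1 ^ 2 * ((a 0 0 + a 1 1) ^ 2 - 4) = 0 := by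
        linear_combination -(a 0 1 * (f k 0 0 - f k 1 1) + f k 0 1 * (a 0 0 - a 1 1)) * c1 -
          4 * a 0 1 * f k 0 1 * c2 + 4 * f k 0 1 ^ 2 * hda - 4 * a 0 1 ^ 2 * hdk + a 0 1 ^ 2 * h4
      rcases mul_eq_zero.1 this with h | h
      · exact pow_eq_zero_iff (two_ne_zero) |>.1 h
      · linarith
    rw [h0, zero_mul] at c2
    have h1 := (mul_eq_zero.1 c2).resolve_left hq
    apply hf
    rw [map_one]
    exact eq_one_of_zero htk h0 h1

open scoped commutatorElement in
theorem exists_abelian_normal_s6 (K : Type*) [Group K] [Group.IsSolvable K] [Nontrivial K] :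
    ∃ A : Subgroup K, A.Normal ∧ (∃ a ∈ A, a ≠ 1) ∧ ∀ a ∈ A, ∀ b ∈ A, a * b = b * a := by
  classical
  have hex : ∃ n, derivedSeries K n = ⊥ := Group.IsSolvable.solvable
  have hspec := Nat.find_spec hex
  have hmin := fun m => Nat.find_min hex (m := m)
  generalize Nat.find hex = n at hspec hmin
  cases n with
  | zero => rw [derivedSeries_zero] at hspec; exact absurd hspec top_ne_bot
  | succ n =>
    refine ⟨derivedSeries K n, inferInstance, ?_, ?_⟩
    · exact (Subgroup.ne_bot_iff_exists_ne_one.1 (hmin n (Nat.lt_succ_self n))).elim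
        fun x hx => ⟨x.1, x.2, fun h => hx (Subtype.ext h)⟩
    · intro a ha b hb
      have : ⁅a, b⁆ ∈ derivedSeries K (n + 1) := by
        rw [derivedSeries_succ]; exact Subgroup.commutator_mem_commutator ha hb
      rw [hspec, Subgroup.mem_bot, commutatorElement_eq_one_iff_mul_comm] at this
      exact this

theorem cyclic_main {K : Type*} [Group K] [Group.IsSolvable K] (f : K →* SL2Z)
    (hf : Function.Injective f) (hG : ∀ k, f k ∈ CongruenceSubgroup.Gamma 3) : IsCyclic K := by
  rcases subsingleton_or_nontrivial K with h | h
  · infer_instance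
  obtain ⟨A, hN, ⟨a, haA, ha1⟩, hcomm⟩ := exists_abelian_normal_s6 K
  have hfa : f a ≠ 1 := by
    intro h; exact ha1 (hf (by rw [h, map_one]))
  have hc : ∀ k, f a * f k = f k * f a := by
    intro k
    have hb := hN.conj_mem a haA k
    have := key_comm (b := f (k * a * k⁻¹)) (hG a) (hG k) hfa
      (by rw [← map_mul, ← map_mul]; congr 1; group)
      (by rw [← map_mul, ← map_mul, hcomm _ haA _ hb])
    have h2 := hf this
    rw [← map_mul, ← map_mul]
    congr 1
    exact (mul_inv_eq_iff_eq_mul.1 h2).symm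
  obtain ⟨c, hcc⟩ := trace_gamma (hG a)
  by_cases ht : f a 0 0 + f a 1 1 = 2
  · exact cyclic_parabolic f hf hG (f a) hfa ht hc
  · refine cyclic_hyperbolic f hf hG (f a) ?_ hc
    rw [hcc]
    have : c ≠ 0 := by rintro rfl; omega
    rcases lt_or_gt_of_ne this with h | h <;> nlinarith

/-- A virtually solvable subgroup of `SL(2,ℤ)` is either finite, or it
contains a finite-index subgroup isomorphic to `ℤ`. -/
theorem virtually_solvable_subgroup_sl2z_finite_or_virtually_Z
    (G : Subgroup SL2Z)
    (hvs : ∃ H : Subgroup G, IsSolvable H ∧ H.FiniteIndex) :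
    Finite G ∨ ∃ H : Subgroup G, H.FiniteIndex ∧ Nonempty (H ≃* Multiplicative ℤ) := by
  obtain ⟨H, hs, hfi⟩ := hvs
  let K : Subgroup G := H ⊓ (CongruenceSubgroup.Gamma 3).subgroupOf G
  have hK : K.FiniteIndex := by
    have : (CongruenceSubgroup.Gamma 3).FiniteIndex := inferInstance
    infer_instance
  have hs' : Group.IsSolvable H := hs
  have hKs : Group.IsSolvable K :=
    Group.isSolvable_of_isSolvable_injective (f := Subgroup.inclusion (inf_le_left : K ≤ H))
      (Subgroup.inclusion_injective _)
  have hcyc : IsCyclic K := cyclic_main (G.subtype.comp K.subtype)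
    (G.subtype_injective.comp K.subtype_injective) (fun k => k.2.2)
  rcases finite_or_infinite K with h | h
  · left
    exact (Subgroup.finite_iff_finite_and_finiteIndex (H := K)).2 ⟨h, hK⟩
  · right
    exact ⟨K, hK, ⟨(intCyclicMulEquiv (G := K)).symm⟩⟩
end
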